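/- Let n ≥ 2 be an integer. Then for every real number x, Σ_{k=0}^{n} B_k(x) B_{n-k}(x) − 2 Σ_{l=2}^{n} C(n+1, l+1) · B_l B_{n-l}(x) / (l+2) = (n+1) B_n(x). -/

import Mathlib

open Finset

/-- The `n`-th Bernoulli polynomial evaluated at a real `x`:
`B_n(x) = ∑_{k=0}^n (n choose k) B_k x^(n-k)`, where `B_k` is the `k`-th Bernoulli number
(with the convention `B_1 = -1/2`, i.e. generating function `z e^{xz}/(e^z - 1)`). -/
noncomputable def bernoulliPoly (n : ℕ) (x : ℝ) : ℝ :=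
  ∑ k ∈ Finset.range (n + 1), ((bernoulli k : ℚ) : ℝ) * (n.choose k : ℝ) * x ^ (n - k)

/-- The `n`-th harmonic number `H_n = ∑_{k=1}^n 1/k` as a real number. -/
noncomputable def harm (n : ℕ) : ℝ :=
  ∑ k ∈ Finset.range n, (1 : ℝ) / (k + 1)

open Polynomial in
noncomputable def auxS (n : ℕ) : ℚ[X] :=
  ∑ k ∈ Finset.range (n + 1), Polynomial.bernoulli k * Polynomial.bernoulli (n - k)

open Polynomial in
noncomputable def auxT (n : ℕ) : ℚ[X] :=
  ∑ l ∈ Finset.Icc 2 n, C (((n + 1).choose (l + 1) : ℚ) * _root_.bernoulli l / ((l : ℚ) + 2)) *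
    Polynomial.bernoulli (n - l)

open Polynomial in
noncomputable def auxD (n : ℕ) : ℚ[X] :=
  auxS n - 2 * auxT n - ((n : ℚ[X]) + 1) * Polynomial.bernoulli n

open Polynomial in
lemma auxS_deriv (n : ℕ) : derivative (auxS (n + 1)) = ((n : ℚ[X]) + 2) * auxS n := by
  unfold auxS
  simp only [derivative_sum, derivative_mul, Polynomial.derivative_bernoulli, Finset.sum_add_distrib]
  rw [Finset.sum_range_succ']
  conv_lhs => rw [add_comm]
  rw [Finset.sum_range_succ]
  simp only [Nat.cast_zero, zero_mul, mul_zero, add_zero, Nat.sub_self, add_tsub_cancel_right,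
    Nat.add_sub_add_right]
  rw [← Finset.sum_add_distrib, Finset.mul_sum]
  apply Finset.sum_congr rfl
  intro k hk
  have hk' : k ≤ n := by simpa [Nat.lt_succ_iff] using hk
  obtain ⟨m, rfl⟩ := Nat.exists_eq_add_of_le hk'
  rw [show k + m + 1 - k = m + 1 by omega, show k + m - k = m by omega]
  simp only [add_tsub_cancel_right]
  push_cast
  ring

open Polynomial in
lemma auxT_deriv (n : ℕ) (hn : 1 ≤ n) :
    derivative (auxT (n + 1)) = ((n : ℚ[X]) + 2) * auxT n := by
  unfold auxT
  rw [Finset.sum_Icc_succ_top (by omega)]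
  simp only [derivative_add, derivative_sum, derivative_mul, Polynomial.derivative_bernoulli,
    derivative_C, Nat.sub_self, Nat.cast_zero, zero_mul, mul_zero, add_zero, zero_add]
  rw [Finset.mul_sum]
  apply Finset.sum_congr rfl
  intro k hk
  have hk' : k ≤ n := (Finset.mem_Icc.mp hk).2
  obtain ⟨m, rfl⟩ := Nat.exists_eq_add_of_le hk'
  rw [show k + m + 1 - k = m + 1 by omega, show k + m - k = m by omega]
  simp only [add_tsub_cancel_right]
  have h := Nat.choose_mul_succ_eq (k + m + 1) (k + 1)
  rw [show k + m + 1 + 1 - (k + 1) = m + 1 by omega] at h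
  have h' : ((k + m + 1).choose (k + 1) : ℚ) * ((k : ℚ) + m + 2)
      = ((k + m + 1 + 1).choose (k + 1) : ℚ) * (m + 1) := by
    have := congrArg (Nat.cast (R := ℚ)) h
    push_cast at this
    linear_combination this
  have e1 : ((m + 1 : ℕ) : ℚ[X]) = C ((m : ℚ) + 1) := by simp
  have e2 : (((k + m : ℕ) : ℚ[X]) + 2) = C ((k : ℚ) + m + 2) := by
    rw [C_add, C_add, ← map_ofNat C 2]; simp
  rw [e1, e2, ← mul_assoc, ← mul_assoc, ← C_mul, ← C_mul]
  congr 2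
  linear_combination (-_root_.bernoulli k / ((k : ℚ) + 2)) * h'

open Polynomial in
lemma auxD_deriv (n : ℕ) (hn : 1 ≤ n) :
    derivative (auxD (n + 1)) = ((n : ℚ[X]) + 2) * auxD n := by
  unfold auxD
  simp only [derivative_sub, derivative_mul, auxS_deriv, auxT_deriv n hn,
    Polynomial.derivative_bernoulli_add_one]
  simp
  ring

open Polynomial in
lemma bern_eval_one (k : ℕ) : (Polynomial.bernoulli k).eval 1 =
    _root_.bernoulli k + if k = 1 then 1 else 0 := by
  rw [Polynomial.bernoulli_eval_one]
  split_ifs with h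
  · subst h; norm_num
  · rw [bernoulli_eq_bernoulli'_of_ne_one h, add_zero]

open Polynomial in
lemma auxS_per (n : ℕ) : (auxS (n + 3)).eval 1 = (auxS (n + 3)).eval 0 +
    2 * _root_.bernoulli (n + 2) := by
  unfold auxS
  simp only [eval_finsetSum, eval_mul, bern_eval_one, Polynomial.bernoulli_eval_zero]
  have key : ∀ k ∈ Finset.range (n + 3 + 1),
      (_root_.bernoulli k + if k = 1 then 1 else 0) *
        (_root_.bernoulli (n + 3 - k) + if n + 3 - k = 1 then 1 else 0) =
      _root_.bernoulli k * _root_.bernoulli (n + 3 - k) +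
      ((if k = 1 then _root_.bernoulli (n + 2) else 0) +
        (if k = n + 2 then _root_.bernoulli (n + 2) else 0)) := by
    intro k hk
    have := Finset.mem_range.mp hk
    by_cases h1 : k = 1
    · subst h1
      simp [add_mul]
    · by_cases h2 : k = n + 2
      · subst h2
        simp [mul_add]
      · have h3 : n + 3 - k ≠ 1 := by omega
        simp [h1, h2, h3]
  rw [Finset.sum_congr rfl key, Finset.sum_add_distrib, Finset.sum_add_distrib]
  simp [Finset.sum_ite_eq']
  ring

open Polynomial in
lemma auxT_per (n : ℕ) : (auxT (n + 3)).eval 1 = (auxT (n + 3)).eval 0 +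
    _root_.bernoulli (n + 2) := by
  unfold auxT
  simp only [eval_finsetSum, eval_mul, bern_eval_one, Polynomial.bernoulli_eval_zero, eval_C,
    mul_add, Finset.sum_add_distrib]
  congr 1
  rw [Finset.sum_eq_single (n + 2)]
  · have : n + 3 - (n + 2) = 1 := by omega
    rw [this, show n + 2 + 1 = n + 3 from rfl, Nat.choose_succ_self_right]
    have : (n : ℚ) + 2 + 2 ≠ 0 := by positivity
    push_cast
    field_simp
    try simp
    try ring
  · intro b hb hb'
    have := Finset.mem_Icc.mp hb
    rw [if_neg (by omega), mul_zero]
  · intro h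
    exact absurd (Finset.mem_Icc.mpr ⟨by omega, by omega⟩) h

open Polynomial in
lemma auxD_per (n : ℕ) : (auxD (n + 3)).eval 1 = (auxD (n + 3)).eval 0 := by
  unfold auxD
  simp only [eval_sub, eval_mul, auxS_per, auxT_per, bern_eval_one,
    Polynomial.bernoulli_eval_zero]
  simp
  ring

open Polynomial in
lemma auxD_two : auxD 2 = 0 := by
  unfold auxD auxS auxT
  have h2 : Polynomial.bernoulli 2 = X ^ 2 - X + C (6⁻¹ : ℚ) := by
    simp [Polynomial.bernoulli, Finset.sum_range_succ, ← C_mul_X_pow_eq_monomial,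
      bernoulli_eq_bernoulli'_of_ne_one (show 2 ≠ 1 by decide)]
    ring_nf
    rw [← map_ofNat C 2, mul_assoc, ← C_mul]
    norm_num
  simp [Finset.sum_range_succ, h2, bernoulli_eq_bernoulli'_of_ne_one (show 2 ≠ 1 by decide)]
  apply Polynomial.funext
  intro r
  simp
  ring

open Polynomial in
lemma auxD_zero (n : ℕ) : auxD (n + 2) = 0 := by
  induction n with
  | zero => exact auxD_two
  | succ n ih =>
    have h1 : derivative (auxD (n + 3)) = 0 := by
      rw [auxD_deriv (n + 2) (by omega), ih, mul_zero]
    obtain ⟨c, hc⟩ : ∃ c, auxD (n + 3) = C c :=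
      ⟨_, eq_C_of_derivative_eq_zero h1⟩
    have h2 : derivative (auxD (n + 4)) = C (((n : ℚ) + 5) * c) := by
      rw [auxD_deriv (n + 3) (by omega), hc, C_mul, C_add, map_ofNat C 5]
      push_cast
      simp only [map_natCast]
      ring
    have h3 : derivative (auxD (n + 4) - C (((n : ℚ) + 5) * c) * X) = 0 := by
      rw [derivative_sub, h2, derivative_C_mul_X, sub_self]
    have h4 := eq_C_of_derivative_eq_zero h3
    have h5 := congrArg (eval 1) h4
    have h6 := congrArg (eval 0) h4
    have h7 := auxD_per (n + 1)
    simp only [eval_sub, eval_mul, eval_C, eval_X] at h5 h6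
    have h8 : ((n : ℚ) + 5) * c = 0 := by
      have h9 : (auxD (n + 4)).eval 1 = (auxD (n + 4)).eval 0 := h7
      linarith
    have : c = 0 := by
      rcases mul_eq_zero.mp h8 with h | h
      · have : (n : ℚ) + 5 ≠ 0 := by positivity
        exact absurd h this
      · exact h
    change auxD (n + 3) = 0
    rw [hc, this, C_0]

lemma bernoulliPoly_eq (n : ℕ) (x : ℝ) :
    bernoulliPoly n x = Polynomial.aeval x (Polynomial.bernoulli n) := by
  simp [bernoulliPoly, Polynomial.bernoulli, Polynomial.aeval_monomial]

theorem stmt_4 (n : ℕ) (hn : 2 ≤ n) (x : ℝ) :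
    (∑ k ∈ Finset.range (n + 1), bernoulliPoly k x * bernoulliPoly (n - k) x) -
      2 * (∑ l ∈ Finset.Icc 2 n, ((n + 1).choose (l + 1) : ℝ) *
        ((bernoulli l : ℚ) : ℝ) * bernoulliPoly (n - l) x / ((l : ℝ) + 2)) =
    ((n : ℝ) + 1) * bernoulliPoly n x := by
  obtain ⟨m, rfl⟩ := Nat.exists_eq_add_of_le' hn
  have h := congrArg (Polynomial.aeval x) (auxD_zero m)
  unfold auxD auxS auxT at h
  simp only [map_sub, map_mul, map_sum, ← bernoulliPoly_eq, Polynomial.aeval_C, map_zero,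
    map_add, map_one, map_natCast, map_ofNat] at h
  rw [← sub_eq_zero, ← h]
  congr 3
  apply Finset.sum_congr rfl
  intro l _
  simp
  ring
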